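/- Every unblocked Cauchy subset of the ternary pseudotree T that converges to the real number r is contained in C_r. Consequently, C_r is the union of all unblocked Cauchy subsets of T that converge to r. -/

import Mathlib

/-- The node `I(k,n) = (k/2^n, (k+2)/2^n)` of the ternary pseudotree; we identify
the node with the pair `(k, n)`, where `n` is its level. -/
def dyadicNode (k n : ℤ) : Set ℝ :=
  Set.Ioo ((k : ℝ) / 2 ^ n) (((k : ℝ) + 2) / 2 ^ n)

/-- A Cauchy subset of `T`: downward closed, containing nodes of arbitrarily high
level, whose deep nodes have left endpoints arbitrarily close together. -/
def IsCauchySubset (S : Set (ℤ × ℤ)) : Prop :=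
  (∀ k n j m : ℤ, (k, n) ∈ S → dyadicNode k n ⊆ dyadicNode j m → (j, m) ∈ S) ∧
  (∀ l : ℤ, ∃ k n : ℤ, (k, n) ∈ S ∧ l < n) ∧
  (∀ p : ℕ, ∃ l : ℤ, ∀ j s k t : ℤ, (j, s) ∈ S → (k, t) ∈ S → l < s → l < t →
    |(j : ℝ) / 2 ^ s - (k : ℝ) / 2 ^ t| < 2 ^ (-(p : ℤ)))

/-- A subset of `T` converges to `r` if nodes of sufficiently high level have
midpoint arbitrarily close to `r`. -/
def ConvergesTo (S : Set (ℤ × ℤ)) (r : ℝ) : Prop :=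
  ∀ ε : ℝ, 0 < ε → ∃ l : ℤ, ∀ k n : ℤ, (k, n) ∈ S → l < n →
    |((k : ℝ) + 1) / 2 ^ n - r| < ε

/-- A subset of `T` is unblocked if every node in it has a child in it; the children
of `(k, n)` are `(2k, n+1)`, `(2k+1, n+1)` and `(2k+2, n+1)`. -/
def Unblocked (S : Set (ℤ × ℤ)) : Prop :=
  ∀ k n : ℤ, (k, n) ∈ S →
    (2 * k, n + 1) ∈ S ∨ (2 * k + 1, n + 1) ∈ S ∨ (2 * k + 2, n + 1) ∈ S

theorem mem_closure_node (r : ℝ) (k n : ℤ) :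
    r ∈ closure (dyadicNode k n) ↔ (k : ℝ) / 2 ^ n ≤ r ∧ r ≤ ((k : ℝ) + 2) / 2 ^ n := by
  have h : (0 : ℝ) < 2 ^ n := by positivity
  have hne : (k : ℝ) / 2 ^ n ≠ ((k : ℝ) + 2) / 2 ^ n := by
    apply ne_of_lt
    gcongr
    linarith
  rw [dyadicNode, closure_Ioo hne, Set.mem_Icc]

theorem descend (S : Set (ℤ × ℤ)) (hS : Unblocked S) (k n : ℤ) (hk : (k, n) ∈ S) (i : ℕ) :
    ∃ j : ℤ, (j, n + i) ∈ S ∧ (k : ℝ) / 2 ^ n ≤ (j : ℝ) / 2 ^ (n + i) ∧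
      ((j : ℝ) + 2) / 2 ^ (n + i) ≤ ((k : ℝ) + 2) / 2 ^ n := by
  induction i with
  | zero => exact ⟨k, by simpa using hk, by simp, by simp⟩
  | succ i ih =>
    obtain ⟨j, hj, h1, h2⟩ := ih
    have e : n + ((i + 1 : ℕ) : ℤ) = (n + i) + 1 := by push_cast; ring
    have hp : (0 : ℝ) < 2 ^ (n + (i : ℤ)) := by positivity
    have e2 : (2 : ℝ) ^ (n + (i : ℤ) + 1) = 2 ^ (n + (i : ℤ)) * 2 := zpow_add_one₀ (by norm_num) _
    rw [e, e2]
    have key : ∀ c : ℤ, 2 * j ≤ c → c ≤ 2 * j + 2 →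
        (k : ℝ) / 2 ^ n ≤ (c : ℝ) / (2 ^ (n + (i : ℤ)) * 2) ∧
        ((c : ℝ) + 2) / (2 ^ (n + (i : ℤ)) * 2) ≤ ((k : ℝ) + 2) / 2 ^ n := by
      intro c hc1 hc2
      have hc1' : (2 : ℝ) * j ≤ c := by exact_mod_cast hc1
      have hc2' : (c : ℝ) ≤ 2 * j + 2 := by exact_mod_cast hc2
      constructor
      · refine h1.trans ?_
        rw [div_le_div_iff₀ hp (by positivity)]
        nlinarith
      · refine le_trans ?_ h2
        rw [div_le_div_iff₀ (by positivity) hp]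
        nlinarith
    rcases hS j _ hj with h | h | h
    · exact ⟨_, h, key _ (by omega) (by omega)⟩
    · exact ⟨_, h, key _ (by omega) (by omega)⟩
    · exact ⟨_, h, key _ (by omega) (by omega)⟩

theorem unblocked_subset (r : ℝ) (S : Set (ℤ × ℤ)) (hU : Unblocked S) (hC : ConvergesTo S r) :
    S ⊆ {p : ℤ × ℤ | r ∈ closure (dyadicNode p.1 p.2)} := by
  rintro ⟨k, n⟩ hk
  simp only [Set.mem_ofPred_eq, mem_closure_node]
  have main : ∀ ε : ℝ, 0 < ε → ∃ x : ℝ, (k : ℝ) / 2 ^ n ≤ x ∧ x ≤ ((k : ℝ) + 2) / 2 ^ n ∧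
      |x - r| < ε := by
    intro ε hε
    obtain ⟨l, hl⟩ := hC ε hε
    obtain ⟨j, hj, h1, h2⟩ := descend S hU k n hk ((l - n).toNat + 1)
    refine ⟨_, h1.trans ?_, le_trans ?_ h2, hl j _ hj (by omega)⟩
    · gcongr
      linarith
    · gcongr
      norm_num
  constructor
  · by_contra! h
    obtain ⟨x, h1, h2, h3⟩ := main _ (sub_pos.2 h)
    rw [abs_lt] at h3
    linarith
  · by_contra! h
    obtain ⟨x, h1, h2, h3⟩ := main _ (sub_pos.2 h)
    rw [abs_lt] at h3
    linarith

theorem Cr_cauchy (r : ℝ) :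
    IsCauchySubset {p : ℤ × ℤ | r ∈ closure (dyadicNode p.1 p.2)} := by
  refine ⟨fun k n j m h hs => closure_mono hs h, fun l => ?_, fun p => ?_⟩
  · refine ⟨⌊r * 2 ^ (l + 1)⌋, l + 1, ?_, by omega⟩
    simp only [Set.mem_ofPred_eq, mem_closure_node]
    have hp : (0 : ℝ) < 2 ^ (l + 1) := by positivity
    rw [div_le_iff₀ hp, le_div_iff₀ hp]
    exact ⟨Int.floor_le _, by linarith [Int.lt_floor_add_one (r * 2 ^ (l + 1))]⟩
  · refine ⟨p + 2, fun j s k t hj hk hs ht => ?_⟩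
    simp only [Set.mem_ofPred_eq, mem_closure_node, add_div] at hj hk
    have key : ∀ s : ℤ, (p : ℤ) + 2 < s → (2 : ℝ) / 2 ^ s < 2 ^ (-(p : ℤ)) := by
      intro s hs
      have : (2 : ℝ) / 2 ^ s = 2 ^ (1 - s) := by
        rw [zpow_sub₀ (by norm_num), zpow_one]
      rw [this]
      exact zpow_lt_zpow_right₀ (by norm_num) (by omega)
    have a := key s hs
    have b := key t ht
    rw [abs_lt]
    constructor <;> linarith

theorem Cr_unblocked (r : ℝ) :
    Unblocked {p : ℤ × ℤ | r ∈ closure (dyadicNode p.1 p.2)} := by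
  intro k n h
  have hp : (0 : ℝ) < 2 ^ n := by positivity
  have e2 : (2 : ℝ) ^ (n + 1) = 2 ^ n * 2 := zpow_add_one₀ (by norm_num) _
  simp only [Set.mem_ofPred_eq, mem_closure_node, e2] at h ⊢
  have hp2 : (0 : ℝ) < 2 ^ n * 2 := by positivity
  simp only [div_le_iff₀ hp, le_div_iff₀ hp, div_le_iff₀ hp2, le_div_iff₀ hp2] at h ⊢
  push_cast
  rcases le_total (r * 2 ^ n) (k + 1) with h' | h'
  · left
    constructor <;> linarith
  · right; right
    constructor <;> linarith

theorem Cr_converges (r : ℝ) :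
    ConvergesTo {p : ℤ × ℤ | r ∈ closure (dyadicNode p.1 p.2)} r := by
  intro ε hε
  obtain ⟨N, hN⟩ := exists_pow_lt_of_lt_one hε (by norm_num : (1 / 2 : ℝ) < 1)
  refine ⟨N, fun k n h hn => ?_⟩
  simp only [Set.mem_ofPred_eq, mem_closure_node, add_div] at h
  have h1 : (1 : ℝ) / 2 ^ n < ε := by
    refine lt_of_le_of_lt ?_ hN
    rw [one_div_pow, ← zpow_natCast (2 : ℝ) N]
    exact one_div_le_one_div_of_le (by positivity) (zpow_le_zpow_right₀ (by norm_num) hn.le)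
  have h2 : (2 : ℝ) / 2 ^ n = 1 / 2 ^ n + 1 / 2 ^ n := by ring
  rw [add_div, abs_lt]
  constructor <;> linarith

/-- Every unblocked Cauchy subset of `T` converging to `r` is
contained in `C_r = {(k,n) : r ∈ closure (I(k,n))}`; consequently `C_r` is the union
of all unblocked Cauchy subsets of `T` converging to `r`. -/
theorem C_r_union_unblocked (r : ℝ) :
    (∀ S : Set (ℤ × ℤ), IsCauchySubset S → Unblocked S → ConvergesTo S r →
      S ⊆ {p : ℤ × ℤ | r ∈ closure (dyadicNode p.1 p.2)}) ∧
    {p : ℤ × ℤ | r ∈ closure (dyadicNode p.1 p.2)} =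
      ⋃₀ {S : Set (ℤ × ℤ) | IsCauchySubset S ∧ Unblocked S ∧ ConvergesTo S r} := by
  refine ⟨fun S _ hU hC => unblocked_subset r S hU hC, Set.Subset.antisymm ?_ ?_⟩
  · exact Set.subset_sUnion_of_mem ⟨Cr_cauchy r, Cr_unblocked r, Cr_converges r⟩
  · exact Set.sUnion_subset fun S hS => unblocked_subset r S hS.2.1 hS.2.2
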